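/- arXiv:math/9906113 — 2 statements merged into one kernel-verified Lean document; each statement's English description precedes it below -/
import Mathlib

section
/- If X is an infinite Hausdorff topological space, then 2^{2^{cf(s^+(X))}} > s^+(X). -/
open Cardinal

/-- `s⁺(X) = sup {|D|⁺ : D ⊆ X a discrete subspace}`. -/
noncomputable def sPlus (X : Type u) [TopologicalSpace X] : Cardinal.{u} :=
  sSup {c : Cardinal.{u} | ∃ D : Set X, DiscreteTopology D ∧ c = Order.succ #D}

theorem rec_exists {K : Type*} [LinearOrder K] [WellFoundedLT K] {γ : Type*}
    (R : (β : K) → ((α : K) → α < β → γ) → γ → Prop) (h : ∀ β f, ∃ v, R β f v) :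
    ∃ f : K → γ, ∀ β, R β (fun α _ => f α) (f β) := by
  choose F hF using h
  let f : K → γ := (wellFounded_lt (α := K)).fix F
  refine ⟨f, fun β => ?_⟩
  have : f β = F β (fun α _ => f α) := WellFounded.fix_eq _ _ _
  rw [this]
  exact hF _ _

theorem ub_exists {ν : Cardinal.{u}} (hν : ν.IsRegular) (s : Set ν.ord.ToType) (hs : #s < ν) :
    ∃ b, ∀ y ∈ s, y < b := by
  rw [← not_isCofinal_iff]
  intro h
  have := Order.cof_le h
  rw [Ordinal.cof_toType, hν.cof_ord] at this
  exact absurd hs (not_lt.2 this)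

theorem mk_Iio_toType_lt (κ : Cardinal.{u}) (k : κ.ord.ToType) : #(Set.Iio k) < κ := by
  have := Cardinal.mk_Iio_lt k (by simp)
  simpa using this

theorem mk_Iio_toType_lt' (o : Cardinal.{u}) (c : Cardinal.{u}) (hc : c < o) :
    ∃ k : o.ord.ToType, #(Set.Iio k) = c := by
  have h : c.ord < Ordinal.type (fun x y : o.ord.ToType => x < y) := by
    rw [Ordinal.type_toType]; exact Cardinal.ord_lt_ord.2 hc
  obtain ⟨k, hk⟩ := Ordinal.typein_surj _ h
  refine ⟨k, ?_⟩
  have := Ordinal.card_typein (r := fun x y : o.ord.ToType => x < y) k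
  rw [hk, Cardinal.card_ord] at this
  exact this.symm

theorem succ_pow {τ κ : Cardinal.{u}} (hτ : ℵ₀ ≤ τ) (hk : κ ≤ τ) (h0 : κ ≠ 0) (h : τ ^ κ = τ) :
    (Order.succ τ) ^ κ = Order.succ τ := by
  have hreg := isRegular_succ hτ
  set θ := Order.succ τ with hθ
  apply le_antisymm
  · let K := κ.ord.ToType
    let N := θ.ord.ToType
    have hK : #K = κ := by simp [K]
    have hN : #N = θ := by simp [N]
    have e : #(K → N) = θ ^ κ := by rw [← hK, ← hN]; simp
    rw [← e, ← Cardinal.mk_univ]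
    have hu : (Set.univ : Set (K → N)) ⊆ ⋃ b : N, {f | ∀ k, f k < b} := by
      intro f _
      obtain ⟨b, hb⟩ := ub_exists hreg (Set.range f)
        (lt_of_le_of_lt Cardinal.mk_range_le (by rw [hK]; exact lt_of_le_of_lt hk (Order.lt_succ _)))
      exact Set.mem_iUnion.2 ⟨b, fun k => hb _ ⟨k, rfl⟩⟩
    refine (Cardinal.mk_le_mk_of_subset hu).trans ?_
    refine (Cardinal.mk_iUnion_le _).trans ?_
    have : ∀ b : N, #{f : K → N | ∀ k, f k < b} ≤ θ := by
      intro b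
      have h1 : #{f : K → N | ∀ k, f k < b} ≤ #(K → Set.Iio b) := by
        refine Cardinal.mk_le_of_injective (f := fun f k => ⟨f.1 k, f.2 k⟩) ?_
        intro f g hfg
        ext k
        have := congrFun hfg k
        exact congrArg Subtype.val this
      refine h1.trans ?_
      have h2 : #(Set.Iio b) ≤ τ := Order.lt_succ_iff.1 (mk_Iio_toType_lt θ b)
      calc #(K → Set.Iio b) = #(Set.Iio b) ^ κ := by rw [← hK]; simp
        _ ≤ τ ^ κ := Cardinal.power_le_power_right h2
        _ = τ := h
        _ ≤ θ := Order.le_succ _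
    calc #N * _ ≤ θ * θ := mul_le_mul' hN.le (ciSup_le' this)
      _ = θ := Cardinal.mul_eq_self (hτ.trans (Order.le_succ _))
  · exact Cardinal.self_le_power _ (Cardinal.one_le_iff_ne_zero.2 h0)

/-- regular cofinal sequence -/
theorem seq_exists {l b : Cardinal.{u}} (hl : Order.IsSuccLimit l) (hb : b < l)
    (h0 : ℵ₀ < l) : ∃ ρ : l.ord.cof.ord.ToType → Cardinal.{u}, StrictMono ρ ∧
      (∀ k, (ρ k).IsRegular) ∧ (∀ k, b < ρ k) ∧ (∀ k, ρ k < l) ∧ ∀ c < l, ∃ k, c ≤ ρ k := by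
  set K := l.ord.cof.ord.ToType with hKdef
  obtain ⟨s, hs, hsc⟩ := Order.exists_cof_eq l.ord.ToType
  rw [Ordinal.cof_toType] at hsc
  have hK : #K = #s := by rw [hsc]; simp [K]
  obtain ⟨g⟩ := Cardinal.eq.1 hK
  let hh : K → Cardinal.{u} := fun k => #(Set.Iio (g k).1)
  have hhl : ∀ k, hh k < l := fun k => mk_Iio_toType_lt l _
  obtain ⟨f, hf⟩ := rec_exists (K := K) (γ := Set.Iio l)
    (fun β f v => v.1.IsRegular ∧ b < v.1 ∧ hh β ≤ v.1 ∧ ∀ α (h : α < β), (f α h).1 < v.1) (by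
      intro β f
      let sp : Cardinal.{u} := ⨆ a : Set.Iio β, (f a.1 a.2).1
      have hsp : sp < l := by
        apply Cardinal.iSup_lt_of_lt_cof_ord
        · exact mk_Iio_toType_lt _ β
        · intro i; exact (f i.1 i.2).2
      let m := max (max b ℵ₀) (max (hh β) sp)
      have hm : m < l := max_lt (max_lt hb h0) (max_lt (hhl β) hsp)
      refine ⟨⟨Order.succ m, hl.succ_lt hm⟩, ?_, ?_, ?_, ?_⟩
      · exact isRegular_succ ((le_max_right _ _).trans (le_max_left _ _))
      · exact Order.lt_succ_of_le ((le_max_left _ _).trans (le_max_left _ _))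
      · exact ((le_max_left _ _).trans (le_max_right _ _)).trans (Order.le_succ _)
      · intro α h
        refine Order.lt_succ_of_le (le_trans ?_ ((le_max_right _ _).trans (le_max_right _ _)))
        exact le_ciSup (f := fun a : Set.Iio β => (f a.1 a.2).1) Cardinal.bddAbove_of_small ⟨α, h⟩)
  refine ⟨fun k => (f k).1, fun a b h => (hf b).2.2.2 a h, fun k => (hf k).1, fun k => (hf k).2.1,
    fun k => (f k).2, fun c hc => ?_⟩
  obtain ⟨x, hx⟩ := mk_Iio_toType_lt' l c hc
  obtain ⟨y, hy, hxy⟩ := hs x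
  refine ⟨g.symm ⟨y, hy⟩, ?_⟩
  refine le_trans ?_ (hf _).2.2.1
  simp only [hh, Equiv.apply_symm_apply]
  rw [← hx]
  exact Cardinal.mk_le_mk_of_subset (Set.Iio_subset_Iio hxy)

def Dsc {X : Type u} [TopologicalSpace X] (D : Set X) : Prop :=
  ∀ x ∈ D, ∃ U, IsOpen U ∧ x ∈ U ∧ ∀ y ∈ U, y ∈ D → y = x

theorem dsc_iff {X : Type u} [TopologicalSpace X] (D : Set X) : DiscreteTopology D ↔ Dsc D := by
  rw [discreteTopology_iff_isOpen_singleton]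
  constructor
  · intro h x hx
    obtain ⟨U, hU, he⟩ := isOpen_induced_iff.1 (h ⟨x, hx⟩)
    refine ⟨U, hU, ?_, ?_⟩
    · have : (⟨x, hx⟩ : D) ∈ (Subtype.val ⁻¹' U : Set D) := by rw [he]; rfl
      exact this
    · intro y hy hyD
      have : (⟨y, hyD⟩ : D) ∈ (Subtype.val ⁻¹' U : Set D) := hy
      rw [he] at this
      exact congrArg Subtype.val this
  · intro h x
    obtain ⟨U, hU, hx, hy⟩ := h x.1 x.2
    refine isOpen_induced_iff.2 ⟨U, hU, ?_⟩
    ext y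
    constructor
    · intro h; exact Subtype.ext (hy _ h y.2)
    · rintro rfl; exact hx

theorem Dsc.mono {X : Type u} [TopologicalSpace X] {D E : Set X} (h : Dsc D) (hE : E ⊆ D) :
    Dsc E := by
  intro x hx
  obtain ⟨U, h1, h2, h3⟩ := h x (hE hx)
  exact ⟨U, h1, h2, fun y hy hyE => h3 y hy (hE hyE)⟩

theorem union_dsc {X : Type u} [TopologicalSpace X] {ι : Type*} (E O : ι → Set X)
    (hE : ∀ i, Dsc (E i)) (hO : ∀ i, IsOpen (O i)) (hEO : ∀ i, E i ⊆ O i)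
    (hd : ∀ i j, i ≠ j → ∀ x ∈ O i, x ∉ E j) : Dsc (⋃ i, E i) := by
  intro x hx
  obtain ⟨i, hi⟩ := Set.mem_iUnion.1 hx
  obtain ⟨U, h1, h2, h3⟩ := hE i x hi
  refine ⟨U ∩ O i, h1.inter (hO i), ⟨h2, hEO i hi⟩, ?_⟩
  intro y hy hyE
  obtain ⟨j, hj⟩ := Set.mem_iUnion.1 hyE
  by_cases hij : i = j
  · subst hij; exact h3 y hy.1 hj
  · exact absurd hj (hd i j hij y hy.2)

/-- All discrete subsets are smaller than `ν`. -/
def Sm {X : Type u} [TopologicalSpace X] (ν : Cardinal.{u}) (T : Set X) : Prop :=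
  ∀ D ⊆ T, Dsc D → #D < ν

theorem Sm.mono {X : Type u} [TopologicalSpace X] {ν : Cardinal.{u}} {S T : Set X}
    (h : Sm ν T) (hS : S ⊆ T) : Sm ν S := fun D hD hd => h D (hD.trans hS) hd

theorem Sm.le {X : Type u} [TopologicalSpace X] {ν μ : Cardinal.{u}} {T : Set X}
    (h : Sm ν T) (hS : ν ≤ μ) : Sm μ T := fun D hD hd => (h D hD hd).trans_le hS

theorem Sm.iUnion {X : Type u} [TopologicalSpace X] {ν : Cardinal.{u}} (hν : ν.IsRegular)
    {ι : Type u} (hι : #ι < ν) (T : ι → Set X) (h : ∀ i, Sm ν (T i)) : Sm ν (⋃ i, T i) := by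
  intro D hD hd
  have : D = ⋃ i, T i ∩ D := by
    rw [← Set.iUnion_inter]; exact (Set.inter_eq_right.2 hD).symm
  rw [this, card_iUnion_lt_iff_forall_of_isRegular hν hι]
  exact fun i => h i _ Set.inter_subset_left (hd.mono Set.inter_subset_right)

theorem closure_exists {γ K : Type u} {θ : Cardinal.{u}} (hθ : ℵ₀ ≤ θ) (hK : θ ^ #K = θ)
    (F : (K → γ) → Set γ) (hF : ∀ s, #(F s) ≤ θ) (hne : ∀ s, (F s).Nonempty) (g0 : γ) :
    ∃ G : Set γ, #G ≤ θ ∧ g0 ∈ G ∧ ∀ s : K → γ, (∀ k, s k ∈ G) → F s ⊆ G := by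
  have h1 : ∀ s, ∃ e : θ.out → γ, Set.range e = F s := by
    intro s
    have : #(F s) ≤ #θ.out := by simpa using hF s
    have := (hne s).to_subtype
    obtain ⟨i⟩ := (Cardinal.le_def _ _).1 ‹#(F s) ≤ #θ.out›
    refine ⟨fun a => (Function.invFun i a).1, ?_⟩
    ext y
    constructor
    · rintro ⟨a, rfl⟩; exact Subtype.coe_prop _
    · intro hy
      refine ⟨i ⟨y, hy⟩, ?_⟩
      simp only [Function.leftInverse_invFun i.injective _]
  choose e he using h1
  let ar : Option θ.out → Type u := fun o => Option.elim o PEmpty (fun _ => K)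
  let W := WType ar
  let step : (Σ a : Option θ.out, ar a → γ) → γ := fun p =>
    match p with
    | ⟨none, _⟩ => g0
    | ⟨some a, s⟩ => e s a
  let φ : W → γ := WType.elim γ step
  refine ⟨Set.range φ, ?_, ?_, ?_⟩
  · refine Cardinal.mk_range_le.trans (WType.cardinalMk_le_of_le ?_)
    have h1 : ∀ a, θ ^ #(ar a) ≤ θ := by
      rintro (_ | a)
      · simpa [ar] using Cardinal.one_le_aleph0.trans hθ
      · simpa [ar] using hK.le
    refine (Cardinal.sum_le_sum _ _ h1).trans ?_
    rw [Cardinal.sum_const']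
    have h2 : #(Option θ.out) = θ := by
      simp [Cardinal.mk_option, Cardinal.add_eq_left hθ (Cardinal.one_le_aleph0.trans hθ)]
    rw [h2, Cardinal.mul_eq_self hθ]
  · exact ⟨WType.mk none PEmpty.elim, rfl⟩
  · intro s hs y hy
    choose t ht using hs
    rw [← he s] at hy
    obtain ⟨a, rfl⟩ := hy
    refine ⟨WType.mk (some a) t, ?_⟩
    show e (fun k => φ (t k)) a = _
    congr 2
    exact funext ht

theorem fibers_exist {S N : Type u} (hS : ℵ₀ ≤ #S) (hN : #N ≤ #S) (hN0 : Nonempty N) :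
    ∃ g : S → N, ∀ i, ∃ φ : S → S, Function.Injective φ ∧ ∀ s, g (φ s) = i := by
  have : #S = #(S × N) := by
    rw [Cardinal.mk_prod, Cardinal.lift_id, Cardinal.lift_id,
      Cardinal.mul_eq_left hS hN (Cardinal.mk_ne_zero_iff.2 hN0)]
  obtain ⟨e⟩ := Cardinal.eq.1 this
  refine ⟨fun s => (e s).2, fun i => ⟨fun s => e.symm (s, i), ?_, ?_⟩⟩
  · intro a b h
    have := e.symm.injective h
    exact congrArg Prod.fst this
  · intro s; simp

theorem hajnal {X : Type u} [TopologicalSpace X] {l ν : Cardinal.{u}}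
    (hl : Order.IsSuccLimit l) (h0 : ℵ₀ < l) (hall : ∀ D : Set X, Dsc D → #D < l) (Z : Set X)
    (hν : ν.IsRegular) (hκ : l.ord.cof < ν) (hνl : ν < l)
    (hloc : ∀ x ∈ Z, ∃ V, IsOpen V ∧ x ∈ V ∧ Sm ν (V ∩ Z))
    (hbig : ∀ c < l, ∃ D ⊆ Z, Dsc D ∧ c ≤ #D) : False := by
  classical
  obtain ⟨ρ, hmono, hreg, hbase, hlt, hcof⟩ := seq_exists hl hνl h0
  let K := l.ord.cof.ord.ToType
  have hK : #K = l.ord.cof := by simp [K]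
  have hIio : ∀ k : K, #(Set.Iio k) < ν := fun k => (mk_Iio_toType_lt _ k).trans hκ
  have hD : ∀ k : K, ∃ D ⊆ Z, Dsc D ∧ #D = ρ k := by
    intro k
    obtain ⟨D, hDZ, hd, hc⟩ := hbig _ (hlt k)
    obtain ⟨E, hE, hEc⟩ := Cardinal.le_mk_iff_exists_subset.1 hc
    exact ⟨E, hE.trans hDZ, hd.mono hE, hEc⟩
  choose D hDZ hDd hDc using hD
  have hV : ∀ x, ∃ V, x ∈ Z → IsOpen V ∧ x ∈ V ∧ Sm ν (V ∩ Z) := by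
    intro x
    by_cases hx : x ∈ Z
    · obtain ⟨V, hV⟩ := hloc x hx; exact ⟨V, fun _ => hV⟩
    · exact ⟨∅, fun h => absurd h hx⟩
  choose V hV using hV
  let D' : K → Set X := fun k => {z | z ∈ D k ∧ ∀ a < k, ∀ x ∈ D a, z ∉ V x}
  have hD'D : ∀ k, D' k ⊆ D k := fun k z hz => hz.1
  have hVD : ∀ x ∈ Z, ∀ k, ∀ E ⊆ D k, #(V x ∩ E : Set X) < ν := by
    intro x hx k E hE
    exact (hV x hx).2.2 _ (Set.inter_subset_inter_right _ (hE.trans (hDZ k)))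
      ((hDd k).mono (Set.inter_subset_right.trans hE))
  have hD'c : ∀ k, ρ k ≤ #(D' k) := by
    intro k
    by_contra hcon
    rw [not_le] at hcon
    let A : Set X := ⋃ a : Set.Iio k, D a.1
    have hA : #A < ρ k := by
      rw [card_iUnion_lt_iff_forall_of_isRegular (hreg k) ((hIio k).trans (hbase k))]
      intro a; rw [hDc]; exact hmono a.2
    have hB : #(⋃ x : A, V x.1 ∩ D k : Set X) < ρ k := by
      rw [card_iUnion_lt_iff_forall_of_isRegular (hreg k) hA]
      rintro ⟨x, hx⟩
      obtain ⟨a, ha⟩ := Set.mem_iUnion.1 hx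
      exact (hVD x (hDZ _ ha) k _ le_rfl).trans (hbase k)
    have hsub : D k ⊆ D' k ∪ ⋃ x : A, V x.1 ∩ D k := by
      intro z hz
      by_cases hzD : z ∈ D' k
      · exact Or.inl hzD
      · right
        have : ¬ ∀ a < k, ∀ x ∈ D a, z ∉ V x := fun h => hzD ⟨hz, h⟩
        push Not at this
        obtain ⟨a, hak, x, hx, hzx⟩ := this
        exact Set.mem_iUnion.2 ⟨⟨x, Set.mem_iUnion.2 ⟨⟨a, hak⟩, hx⟩⟩, hzx, hz⟩
    have := ((Cardinal.mk_le_mk_of_subset hsub).trans (Cardinal.mk_union_le _ _)).trans_lt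
      (Cardinal.add_lt_of_lt (hreg k).aleph0_le hcon hB)
    rw [hDc] at this
    exact lt_irrefl _ this
  let N := ν.ord.ToType
  have hN : #N = ν := by simp [N]
  have hN0 : Nonempty N := Cardinal.mk_ne_zero_iff.1 (by rw [hN]; exact hν.pos.ne')
  obtain ⟨f, hf⟩ := rec_exists (K := K) (γ := (X → N) × N)
    (fun β f v => (∀ x ∈ D' β, ∀ α (h : α < β), ∀ y ∈ V x, y ∈ D' α → (f α h).1 y < v.1 x) ∧
      ∀ i ≥ v.2, ρ β ≤ #{x | x ∈ D' β ∧ v.1 x = i}) (by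
    intro β f
    have hj : ∀ x, ∃ j : N, x ∈ D' β → ∀ α (h : α < β), ∀ y ∈ V x, y ∈ D' α → (f α h).1 y < j := by
      intro x
      by_cases hx : x ∈ D' β
      · have hc : #(⋃ a : Set.Iio β, (f a.1 a.2).1 '' (V x ∩ D' a.1) : Set N) < ν := by
          rw [card_iUnion_lt_iff_forall_of_isRegular hν (hIio β)]
          intro a
          exact Cardinal.mk_image_le.trans_lt (hVD x (hDZ β hx.1) a.1 _ (hD'D _))
        obtain ⟨j, hj⟩ := ub_exists hν _ hc
        refine ⟨j, fun _ α h y hy hyD => hj _ (Set.mem_iUnion.2 ⟨⟨α, h⟩, y, ⟨hy, hyD⟩, rfl⟩)⟩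
      · exact ⟨hN0.some, fun h => absurd h hx⟩
    choose j hj using hj
    obtain ⟨j0, t, ht, htc, htj⟩ := Cardinal.infinite_pigeonhole_set (s := D' β)
      (fun x => j x.1) (ρ β) (hD'c β) (hreg β).aleph0_le
      (by rw [(hreg β).cof_ord, hN]; exact hbase β)
    obtain ⟨g, hg⟩ := fibers_exist (S := t) (N := N) ((hreg β).aleph0_le.trans htc)
      (by rw [hN]; exact (hbase β).le.trans htc) hN0
    refine ⟨(fun x => if h : x ∈ t then max j0 (g ⟨x, h⟩) else j x, j0), ?_, ?_⟩
    · intro x hx α h y hy hyD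
      have := hj x hx α h y hy hyD
      by_cases hxt : x ∈ t
      · simp only [hxt, dif_pos]
        have e : j x = j0 := htj hxt
        rw [e] at this
        exact lt_of_lt_of_le this (le_max_left _ _)
      · simp only [hxt, dif_neg, not_false_eq_true]; exact this
    · intro i hi
      refine htc.trans ?_
      obtain ⟨φ, hφ, hgφ⟩ := hg i
      refine Cardinal.mk_le_of_injective (f := fun s : t => ⟨(φ s).1, ht (φ s).2, ?_⟩) ?_
      · simp only [(φ s).2, dif_pos, Subtype.coe_eta, hgφ]
        exact max_eq_right hi
      · intro a b hab
        apply hφ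
        have h := congrArg (fun z => z.1) hab
        exact Subtype.ext h)
  obtain ⟨i, hi⟩ := ub_exists hν (Set.range fun k => (f k).2)
    (Cardinal.mk_range_le.trans_lt (by rw [hK]; exact hκ))
  let E : K → Set X := fun k => {x | x ∈ D' k ∧ (f k).1 x = i}
  have hEc : ∀ k, ρ k ≤ #(E k) := fun k => (hf k).2 i (hi _ ⟨k, rfl⟩).le
  have hdsc : Dsc (⋃ k, E k) := by
    apply union_dsc E (fun k => ⋃ x ∈ E k, V x)
    · exact fun k => (hDd k).mono fun x hx => hx.1.1
    · exact fun k => isOpen_biUnion fun x hx => (hV x (hDZ k hx.1.1)).1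
    · exact fun k x hx => Set.mem_biUnion hx (hV x (hDZ k hx.1.1)).2.1
    · intro k m hkm x hx hxm
      obtain ⟨z, hz, hxz⟩ := Set.mem_iUnion₂.1 hx
      rcases lt_or_gt_of_ne hkm with h | h
      · exact hxm.1.2 k h z hz.1.1 hxz
      · have := (hf k).1 z hz.1 m h x hxz hxm.1
        rw [hz.2, hxm.2] at this
        exact lt_irrefl _ this
  have h1 := hall _ hdsc
  obtain ⟨k, hk⟩ := hcof _ (hl.succ_lt h1)
  have h2 : #(E k) ≤ #(⋃ k, E k : Set X) := Cardinal.mk_le_mk_of_subset (Set.subset_iUnion E k)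
  exact absurd (Order.lt_succ #(⋃ k, E k : Set X)) (not_lt.2 ((hk.trans (hEc k)).trans h2))

/-- Points of `Z` that are not locally small. -/
def Bad {X : Type u} [TopologicalSpace X] (μ : Cardinal.{u}) (Z : Set X) : Set X :=
  {y | y ∈ Z ∧ ∀ V, IsOpen V → y ∈ V → ¬ Sm μ (V ∩ Z)}

theorem bad_large {X : Type u} [TopologicalSpace X] {l μ θ : Cardinal.{u}}
    (hl : Order.IsSuccLimit l) (h0 : ℵ₀ < l) (hall : ∀ D : Set X, Dsc D → #D < l) (Z : Set X)
    (hμ : μ.IsRegular) (hκ : l.ord.cof < μ) (hμl : μ < l) (hθ : θ < l)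
    (hbig : ∀ c < l, ∃ D ⊆ Z, Dsc D ∧ c ≤ #D) : θ ≤ #(Bad μ Z) := by
  by_contra hcon
  rw [not_le] at hcon
  refine hajnal hl h0 hall (Z \ Bad μ Z) hμ hκ hμl ?_ ?_
  · rintro x ⟨hx, hxB⟩
    have : ¬ ∀ V, IsOpen V → x ∈ V → ¬ Sm μ (V ∩ Z) := fun h => hxB ⟨hx, h⟩
    push Not at this
    obtain ⟨V, h1, h2, h3⟩ := this
    exact ⟨V, h1, h2, h3.mono (Set.inter_subset_inter_right _ Set.sdiff_subset)⟩
  · intro c hc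
    have hm : max (max c θ) ℵ₀ < l := max_lt (max_lt hc hθ) h0
    obtain ⟨D, hDZ, hDd, hDc⟩ := hbig _ hm
    refine ⟨D \ Bad μ Z, Set.sdiff_subset_sdiff_left hDZ, hDd.mono Set.sdiff_subset, ?_⟩
    refine ((le_max_left _ _).trans (le_max_left _ _) : c ≤ max (max c θ) ℵ₀).trans ?_
    by_contra h
    rw [not_le] at h
    have hB : #(Bad μ Z) < max (max c θ) ℵ₀ :=
      hcon.trans_le ((le_max_right _ _).trans (le_max_left _ _))
    have hsub : D ⊆ (D \ Bad μ Z) ∪ Bad μ Z := by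
      intro x hx
      by_cases hxB : x ∈ Bad μ Z
      · exact Or.inr hxB
      · exact Or.inl ⟨hx, hxB⟩
    exact absurd (((Cardinal.mk_le_mk_of_subset hsub).trans (Cardinal.mk_union_le _ _)).trans_lt
      (Cardinal.add_lt_of_lt (le_max_right _ _) h hB)) (not_lt.2 hDc)

theorem cset_le {X : Type u} [TopologicalSpace X] (G : Set (Set X)) (Y : Set X)
    (hsep : ∀ y ∈ Y, ∀ y' ∈ Y, y ≠ y' → ∃ V ∈ G, ∃ W ∈ G, IsOpen V ∧ IsOpen W ∧ y ∈ V ∧ y' ∈ W ∧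
      Disjoint V W) (hint : ∀ V ∈ G, ∀ W ∈ G, V ∩ W ∈ G) (Q : Set X) :
    #{y | y ∈ Y ∧ ∀ V ∈ G, IsOpen V → y ∈ V → (V ∩ Q).Nonempty} ≤
      (2 : Cardinal.{u}) ^ ((2 : Cardinal.{u}) ^ #Q) := by
  have e : (2 : Cardinal.{u}) ^ ((2 : Cardinal.{u}) ^ #Q) = #(Set (Set Q)) := by simp
  rw [e]
  refine Cardinal.mk_le_of_injective
    (f := fun y => {A : Set Q | ∃ V ∈ G, IsOpen V ∧ y.1 ∈ V ∧ A = Subtype.val ⁻¹' V}) ?_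
  rintro ⟨y, hy, hyC⟩ ⟨y', hy', hyC'⟩ h
  by_contra hne
  have hne' : y ≠ y' := fun h => hne (Subtype.ext h)
  obtain ⟨V, hV, W, hW, hVo, hWo, hyV, hyW, hd⟩ := hsep y hy y' hy' hne'
  have h1 : (Subtype.val ⁻¹' V : Set Q) ∈
      {A : Set Q | ∃ V ∈ G, IsOpen V ∧ y ∈ V ∧ A = Subtype.val ⁻¹' V} := ⟨V, hV, hVo, hyV, rfl⟩
  have h' : {A : Set Q | ∃ V ∈ G, IsOpen V ∧ y ∈ V ∧ A = Subtype.val ⁻¹' V} =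
    {A : Set Q | ∃ V ∈ G, IsOpen V ∧ y' ∈ V ∧ A = Subtype.val ⁻¹' V} := h
  rw [h'] at h1
  obtain ⟨V', hV', hVo', hyV', he⟩ := h1
  obtain ⟨q, ⟨hq1, hq2⟩, hq⟩ := hyC' (V' ∩ W) (hint _ hV' _ hW) (hVo'.inter hWo) ⟨hyV', hyW⟩
  have : (⟨q, hq⟩ : Q) ∈ (Subtype.val ⁻¹' V : Set Q) := by rw [he]; exact hq1
  exact Set.disjoint_left.1 hd this hq2

theorem main_lemma {X : Type u} [TopologicalSpace X] [T2Space X] [Nonempty X]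
    {l θ : Cardinal.{u}}
    (hl : Order.IsSuccLimit l) (h0 : ℵ₀ < l) (hall : ∀ D : Set X, Dsc D → #D < l)
    (hbig : ∀ c < l, ∃ D : Set X, Dsc D ∧ c ≤ #D)
    (hκ0 : ℵ₀ ≤ l.ord.cof) (hθl : θ < l)
    (hτθ : (2 : Cardinal.{u}) ^ ((2 : Cardinal.{u}) ^ l.ord.cof) < θ)
    (hpow : θ ^ l.ord.cof = θ) : False := by
  classical
  have hκθ : l.ord.cof < θ := ((Cardinal.cantor _).trans (Cardinal.cantor _)).trans hτθ
  have hθ0 : ℵ₀ ≤ θ := hκ0.trans hκθ.le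
  obtain ⟨ρ, hmono, hreg, hbase, hlt, hcof⟩ := seq_exists hl hθl h0
  let K := l.ord.cof.ord.ToType
  have hK : #K = l.ord.cof := by simp [K]
  have hKinf : Infinite K := Cardinal.infinite_iff.2 (by rw [hK]; exact hκ0)
  obtain ⟨k0, k1, hk01⟩ := exists_pair_ne K
  have hbad : ∀ Z : Set X, (∀ c < l, ∃ D ⊆ Z, Dsc D ∧ c ≤ #D) → ∀ k, θ ≤ #(Bad (ρ k) Z) :=
    fun Z hZ k => bad_large hl h0 hall Z (hreg k) (hκθ.trans (hbase k)) (hlt k) hθl hZ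
  have hP : ∀ (k : K) (Z : Set X), ∃ P ⊆ Bad (ρ k) Z, #P ≤ θ ∧ (θ ≤ #(Bad (ρ k) Z) → #P = θ) := by
    intro k Z
    by_cases h : θ ≤ #(Bad (ρ k) Z)
    · obtain ⟨P, hP, hPc⟩ := Cardinal.le_mk_iff_exists_subset.1 h
      exact ⟨P, hP, hPc.le, fun _ => hPc⟩
    · exact ⟨∅, Set.empty_subset _, by simp, fun h' => absurd h' h⟩
  choose P hPB hPle hPeq using hP
  have hU : ∀ y y' : X, ∃ p : Set X × Set X, y ≠ y' → IsOpen p.1 ∧ IsOpen p.2 ∧ y ∈ p.1 ∧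
      y' ∈ p.2 ∧ Disjoint p.1 p.2 := by
    intro y y'
    by_cases h : y = y'
    · exact ⟨(∅, ∅), fun h' => absurd h h'⟩
    · obtain ⟨u, v, h⟩ := t2_separation h
      exact ⟨(u, v), fun _ => h⟩
  choose U hU using hU
  have hpt : ∃ pt : Set X → X, ∀ y, pt {y} = y := by
    refine ⟨fun s => if h : s.Nonempty then h.some else Classical.arbitrary X, fun y => ?_⟩
    have h : ({y} : Set X).Nonempty := Set.singleton_nonempty y
    simp only [h, dif_pos]
    exact h.some_mem
  obtain ⟨pt, hpt⟩ := hpt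
  let fin5 : (K → Set X) → Set (Set X) := fun s =>
    {∅, Set.univ, s k0 ∩ s k1, (U (pt (s k0)) (pt (s k1))).1, (U (pt (s k0)) (pt (s k1))).2}
  let F : (K → Set X) → Set (Set X) := fun s =>
    fin5 s ∪ ⋃ k : K, (fun y => ({y} : Set X)) '' P k (⋃ k, s k)ᶜ
  obtain ⟨G, hGc, hempty, hG⟩ := closure_exists hθ0 (K := K) (by rw [hK]; exact hpow) F (by
    intro s
    refine (Cardinal.mk_union_le _ _).trans ?_
    refine Cardinal.add_le_of_le hθ0 ?_ ?_
    · have : (fin5 s).Finite := by simp [fin5]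
      exact (Cardinal.lt_aleph0_iff_set_finite.2 this).le.trans hθ0
    · refine (Cardinal.mk_iUnion_le _).trans ?_
      rw [← Cardinal.mul_eq_self hθ0]
      refine mul_le_mul' (by rw [hK]; exact hκθ.le) (ciSup_le' fun k => ?_)
      exact Cardinal.mk_image_le.trans (hPle _ _)) (fun s => ⟨∅, Or.inl (by simp [fin5])⟩) ∅
  let sab : Set X → Set X → K → Set X := fun a b k => if k = k0 then a else b
  have hsab0 : ∀ a b, sab a b k0 = a := fun a b => by simp [sab]
  have hsab1 : ∀ a b, sab a b k1 = b := fun a b => by simp [sab, hk01.symm]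
  have hsabG : ∀ a ∈ G, ∀ b ∈ G, ∀ k, sab a b k ∈ G := by
    intro a ha b hb k
    by_cases h : k = k0
    · simpa [sab, h] using ha
    · simpa [sab, h] using hb
  have hfin : ∀ a ∈ G, ∀ b ∈ G, fin5 (sab a b) ⊆ G := fun a ha b hb =>
    Set.subset_union_left.trans (hG (sab a b) (hsabG a ha b hb))
  have huniv : Set.univ ∈ G := hfin ∅ hempty ∅ hempty (by simp [fin5])
  have hint : ∀ V ∈ G, ∀ W ∈ G, V ∩ W ∈ G := by
    intro V hV W hW
    exact hfin V hV W hW (by simp [fin5, hsab0, hsab1])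
  let Y : Set X := {y | {y} ∈ G}
  have hsep : ∀ y ∈ Y, ∀ y' ∈ Y, y ≠ y' → ∃ V ∈ G, ∃ W ∈ G, IsOpen V ∧ IsOpen W ∧ y ∈ V ∧ y' ∈ W ∧
      Disjoint V W := by
    intro y hy y' hy' hne
    obtain ⟨h1, h2, h3, h4, h5⟩ := hU y y' hne
    refine ⟨(U y y').1, ?_, (U y y').2, ?_, h1, h2, h3, h4, h5⟩
    · exact hfin {y} hy {y'} hy' (by simp [fin5, hsab0, hsab1, hpt])
    · exact hfin {y} hy {y'} hy' (by simp [fin5, hsab0, hsab1, hpt])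
  let T : G × (K → G) → Set X := fun p => p.1.1 \ ⋃ k, (p.2 k).1
  have hTc : #(G × (K → G)) ≤ θ := by
    rw [Cardinal.mk_prod, Cardinal.lift_id, Cardinal.lift_id, ← Cardinal.mul_eq_self hθ0]
    refine mul_le_mul' hGc ?_
    calc #(K → G) = #G ^ #K := by simp
      _ ≤ θ ^ #K := Cardinal.power_le_power_right hGc
      _ = θ := by rw [hK]; exact hpow
  have havoid : ∀ (k : K) (S : Set X), ¬ Sm (ρ k) S → ∃ x ∈ S, ∀ p, Sm (ρ k) (T p) → x ∉ T p := by
    intro k S hS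
    by_contra hcon
    push Not at hcon
    apply hS
    have h1 : Sm (ρ k) (⋃ p : {p // Sm (ρ k) (T p)}, T p.1) := by
      apply Sm.iUnion (hreg k)
      · exact ((Cardinal.mk_subtype_le _).trans hTc).trans_lt (hbase k)
      · exact fun p => p.2
    refine h1.mono fun x hx => ?_
    obtain ⟨p, hp, hxp⟩ := hcon x hx
    exact Set.mem_iUnion.2 ⟨⟨p, hp⟩, hxp⟩
  have hxg : ∀ k : K, ∃ x, ∀ p, Sm (ρ k) (T p) → x ∉ T p := by
    intro k
    obtain ⟨x, _, hx⟩ := havoid k Set.univ (by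
      intro h
      obtain ⟨D, hD, hDc⟩ := hbig _ (hlt k)
      exact absurd (h D (Set.subset_univ _) hD) (not_lt.2 hDc))
    exact ⟨x, hx⟩
  choose xg hxg using hxg
  obtain ⟨f, hf⟩ := rec_exists (K := K)
    (γ := {V : Set X // V ∈ G ∧ IsOpen V ∧ ∀ k, xg k ∉ V} × X)
    (fun β f v => (∀ α h, (f α h).2 ∉ v.1.1) ∧ (∀ α h, v.2 ∉ (f α h).1.1) ∧ v.2 ∈ v.1.1 ∧
      ∀ p, Sm (ρ β) (T p) → v.2 ∉ T p) (by
    intro β f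
    let s : K → Set X := fun k => if h : k < β then (f k h).1.1 else ∅
    have hsG : ∀ k, s k ∈ G := by
      intro k
      by_cases h : k < β
      · simpa [s, h] using (f k h).1.2.1
      · simpa [s, h] using hempty
    let Z : Set X := (⋃ k, s k)ᶜ
    have hxZ : ∀ k, xg k ∈ Z := by
      intro k hk
      obtain ⟨m, hm⟩ := Set.mem_iUnion.1 hk
      by_cases h : m < β
      · simp only [s, h, dif_pos] at hm
        exact (f m h).1.2.2.2 k hm
      · simp [s, h] at hm
    have hTZ : T (⟨Set.univ, huniv⟩, fun k => ⟨s k, hsG k⟩) = Z := by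
      simp only [T, Z, Set.compl_eq_univ_sdiff]
    have hZ : ∀ k, ¬ Sm (ρ k) Z := by
      intro k hk
      refine hxg k (⟨Set.univ, huniv⟩, fun k => ⟨s k, hsG k⟩) (by rw [hTZ]; exact hk) ?_
      rw [hTZ]; exact hxZ k
    have hZbig : ∀ c < l, ∃ D ⊆ Z, Dsc D ∧ c ≤ #D := by
      intro c hc
      obtain ⟨k, hk⟩ := hcof c hc
      have := hZ k
      unfold Sm at this
      push Not at this
      obtain ⟨D, h1, h2, h3⟩ := this
      exact ⟨D, h1, h2, hk.trans h3⟩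
    have hPc : #(P β Z) = θ := hPeq β Z (hbad Z hZbig β)
    let Q : Set X := Set.range xg ∪ Set.range (fun a : Set.Iio β => (f a.1 a.2).2)
    have hQ : #Q ≤ l.ord.cof := by
      refine (Cardinal.mk_union_le _ _).trans (Cardinal.add_le_of_le hκ0 ?_ ?_)
      · exact Cardinal.mk_range_le.trans hK.le
      · exact Cardinal.mk_range_le.trans (mk_Iio_toType_lt _ β).le
    have hC := (cset_le G Y hsep hint Q).trans (Cardinal.power_le_power_left two_ne_zero
      (Cardinal.power_le_power_left two_ne_zero hQ))
    have hy : ∃ y ∈ P β Z, y ∉ {y | y ∈ Y ∧ ∀ V ∈ G, IsOpen V → y ∈ V → (V ∩ Q).Nonempty} := by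
      by_contra hcon
      push Not at hcon
      have := (Cardinal.mk_le_mk_of_subset (show P β Z ⊆ _ from hcon)).trans hC
      rw [hPc] at this
      exact absurd hτθ (not_lt.2 this)
    obtain ⟨y, hyP, hyC⟩ := hy
    have hyY : y ∈ Y := hG s hsG (Or.inr (Set.mem_iUnion.2 ⟨β, y, hyP, rfl⟩))
    have : ¬ ∀ V ∈ G, IsOpen V → y ∈ V → (V ∩ Q).Nonempty := fun h => hyC ⟨hyY, h⟩
    push Not at this
    obtain ⟨V, hVG, hVo, hyV, hVQ⟩ := this
    have hVQ' : ∀ x ∈ V, x ∉ Q := fun x hx hxQ => by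
      have : x ∈ V ∩ Q := ⟨hx, hxQ⟩
      rw [hVQ] at this
      exact this
    obtain ⟨z, ⟨hzV, hzZ⟩, hz⟩ := havoid β (V ∩ Z) ((hPB β Z hyP).2 V hVo hyV)
    refine ⟨(⟨V, hVG, hVo, fun k hk => hVQ' _ hk (Or.inl ⟨k, rfl⟩)⟩, z), ?_, ?_, hzV, hz⟩
    · intro α h hα
      exact hVQ' _ hα (Or.inr ⟨⟨α, h⟩, rfl⟩)
    · intro α h hα
      apply hzZ
      refine Set.mem_iUnion.2 ⟨α, ?_⟩
      simp only [s, h, dif_pos]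
      exact hα)
  have hE : ∀ k : K, ∃ E ⊆ (f k).1.1, (∀ m, m ≠ k → ∀ x ∈ E, x ∉ (f m).1.1) ∧ Dsc E ∧
      ρ k ≤ #E := by
    intro k
    let s : K → G := fun m => if m = k then ⟨∅, hempty⟩ else ⟨(f m).1.1, (f m).1.2.1⟩
    have hzT : (f k).2 ∈ T (⟨(f k).1.1, (f k).1.2.1⟩, s) := by
      refine ⟨(hf k).2.2.1, ?_⟩
      intro h
      obtain ⟨m, hm⟩ := Set.mem_iUnion.1 h
      by_cases hmk : m = k
      · simp [s, hmk] at hm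
      · simp only [s, hmk, if_false] at hm
        rcases lt_or_gt_of_ne hmk with h' | h'
        · exact (hf k).2.1 m h' hm
        · exact (hf m).1 k h' hm
    have hn : ¬ Sm (ρ k) (T (⟨(f k).1.1, (f k).1.2.1⟩, s)) := fun h => (hf k).2.2.2 _ h hzT
    unfold Sm at hn
    push Not at hn
    obtain ⟨E, h1, h2, h3⟩ := hn
    refine ⟨E, fun x hx => (h1 hx).1, ?_, h2, h3⟩
    intro m hm x hx hxm
    apply (h1 hx).2
    refine Set.mem_iUnion.2 ⟨m, ?_⟩
    simp only [s, hm, if_false]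
    exact hxm
  choose E hE1 hE2 hE3 hE4 using hE
  have hdsc : Dsc (⋃ k, E k) :=
    union_dsc E (fun k => (f k).1.1) hE3 (fun k => (f k).1.2.2.1) hE1
      (fun i j hij x hx hxE => hE2 j i hij x hxE hx)
  have h1 := hall _ hdsc
  obtain ⟨k, hk⟩ := hcof _ (hl.succ_lt h1)
  have h2 : #(E k) ≤ #(⋃ k, E k : Set X) := Cardinal.mk_le_mk_of_subset (Set.subset_iUnion E k)
  exact absurd (Order.lt_succ #(⋃ k, E k : Set X)) (not_lt.2 ((hk.trans (hE4 k)).trans h2))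

/-- For an infinite Hausdorff space `X`, `2^{2^{cf(s⁺(X))}} > s⁺(X)`. -/
theorem stmt10 (X : Type u) [TopologicalSpace X] [T2Space X] [Infinite X] :
    sPlus X < (2 : Cardinal.{u}) ^ ((2 : Cardinal.{u}) ^ (sPlus X).ord.cof) := by
  set S : Set Cardinal.{u} := {c | ∃ D : Set X, DiscreteTopology D ∧ c = Order.succ #D} with hS
  have hbdd : BddAbove S := by
    refine ⟨Order.succ #X, ?_⟩
    rintro c ⟨D, _, rfl⟩
    exact Order.succ_le_succ (Cardinal.mk_set_le D)
  have hall : ∀ D : Set X, Dsc D → #D < sPlus X := by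
    intro D hD
    have : Order.succ #D ≤ sPlus X := le_csSup hbdd ⟨D, (dsc_iff D).2 hD, rfl⟩
    exact Order.succ_le_iff.1 this
  have hSne : S.Nonempty := ⟨_, ∅, inferInstance, rfl⟩
  have hbig : ∀ c < sPlus X, ∃ D : Set X, Dsc D ∧ c ≤ #D := by
    intro c hc
    obtain ⟨_, ⟨D, hD, rfl⟩, hcD⟩ := exists_lt_of_lt_csSup hSne hc
    exact ⟨D, (dsc_iff D).1 hD, Order.lt_succ_iff.1 hcD⟩
  have hfinD : ∀ D : Set X, D.Finite → Dsc D := by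
    intro D hD
    rw [← dsc_iff]
    have := hD.to_subtype
    infer_instance
  have hl0 : ℵ₀ ≤ sPlus X := by
    by_contra hcon
    rw [not_le] at hcon
    obtain ⟨n, hn⟩ := Cardinal.lt_aleph0.1 hcon
    obtain ⟨D, hD⟩ := Infinite.exists_subset_card_eq X n
    have := hall D (hfinD _ D.finite_toSet)
    rw [hn] at this
    simp [hD] at this
  by_contra hcon
  rw [not_lt] at hcon
  set l := sPlus X with hldef
  have hκ0 : ℵ₀ ≤ l.ord.cof := Ordinal.aleph0_le_cof.2 (Cardinal.isSuccLimit_ord hl0)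
  set τ : Cardinal.{u} := (2 : Cardinal.{u}) ^ ((2 : Cardinal.{u}) ^ l.ord.cof) with hτ
  have hκ2 : ℵ₀ ≤ (2 : Cardinal.{u}) ^ l.ord.cof := hκ0.trans (Cardinal.cantor _).le
  have hτ0 : ℵ₀ ≤ τ := hκ2.trans (Cardinal.cantor _).le
  have hκτ : l.ord.cof < τ := (Cardinal.cantor _).trans (Cardinal.cantor _)
  have hne : τ ≠ l := by
    intro h
    have h1 : (2 : Cardinal.{u}) ^ l.ord.cof < τ.ord.cof :=
      Cardinal.lt_cof_ord_power hκ2 Cardinal.one_lt_two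
    rw [h] at h1
    exact absurd h1 (not_lt.2 (Cardinal.cantor _).le)
  have hτl : τ < l := lt_of_le_of_ne hcon hne
  have hsing : l.IsSingular := by
    rcases Cardinal.isRegular_or_isSingular hl0 with h | h
    · have := h.cof_ord
      rw [this] at hκτ
      exact absurd hκτ (not_lt.2 hcon)
    · exact h
  have hlim := hsing.isSuccLimit
  refine main_lemma (X := X) (l := l) (θ := Order.succ τ) hlim (hτ0.trans_lt hτl) hall hbig hκ0
    (hlim.succ_lt hτl) (Order.lt_succ _) (succ_pow hτ0 hκτ.le ?_ ?_)
  · exact (Cardinal.aleph0_pos.trans_le hκ0).ne'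
  · rw [hτ, ← Cardinal.power_mul, Cardinal.mul_eq_left hκ2 (Cardinal.cantor _).le
      (Cardinal.aleph0_pos.trans_le hκ0).ne']
end

section
/- If X is an infinite regular Hausdorff (T_3) topological space, then 2^{cf(s^+(X))} > s^+(X). -/
open Cardinal

universe u

theorem lemT {I P : Type u} (μ : Cardinal.{u}) (hμ : μ.IsRegular) (hI : #I < μ) (hP : μ < #P)
    (H : I × P → Set (I × P)) (hH : ∀ x, #(H x) < μ) :
    ∃ δ : I → P, ∀ α β, α ≠ β → (β, δ β) ∉ H (α, δ α) := by
  by_contra hcon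
  have key : ∀ A : Set (I × P), ∃ (t : Set (I × P)) (i : I), Disjoint t A ∧ #t ≤ #I ∧
      ∀ p, (i, p) ∉ A → ∃ y ∈ t, y ∈ H (i, p) ∨ (i, p) ∈ H y := by
    intro A
    obtain ⟨t, ht⟩ := zorn_subset {t : Set (I × P) | Disjoint t A ∧
      (∀ x ∈ t, ∀ y ∈ t, x.1 = y.1 → x = y) ∧ (∀ x ∈ t, ∀ y ∈ t, x ≠ y → y ∉ H x)} (by
      intro c hc hchain
      refine ⟨⋃₀ c, ⟨?_, ?_, ?_⟩, fun s hs => Set.subset_sUnion_of_mem hs⟩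
      · rw [Set.disjoint_sUnion_left]
        exact fun s hs => (hc hs).1
      · rintro x ⟨s, hs, hx⟩ y ⟨s', hs', hy⟩
        rcases hchain.total hs hs' with h | h
        · exact (hc hs').2.1 x (h hx) y hy
        · exact (hc hs).2.1 x hx y (h hy)
      · rintro x ⟨s, hs, hx⟩ y ⟨s', hs', hy⟩
        rcases hchain.total hs hs' with h | h
        · exact (hc hs').2.2 x (h hx) y hy
        · exact (hc hs).2.2 x hx y (h hy))
    obtain ⟨⟨h1, h2, h3⟩, hmax⟩ := ht
    have hrow : ∃ i, ∀ y ∈ t, y.1 ≠ i := by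
      by_contra hno
      push Not at hno
      choose y hy hy' using hno
      apply hcon
      refine ⟨fun i => (y i).2, fun α β hab => ?_⟩
      have e : ∀ a, (a, (y a).2) = y a := fun a => Prod.ext (hy' a).symm rfl
      rw [e, e]
      apply h3 _ (hy α) _ (hy β)
      intro h
      apply hab
      rw [← hy' α, ← hy' β, h]
    obtain ⟨i, hi⟩ := hrow
    refine ⟨t, i, h1, ?_, ?_⟩
    · refine mk_le_of_injective (f := fun x : t => x.1.1) ?_
      intro x y hxy
      exact Subtype.ext (h2 _ x.2 _ y.2 hxy)
    · intro p hp
      by_contra hno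
      push Not at hno
      have hmem : (i, p) ∈ t := by
        refine hmax (y := insert (i, p) t) ⟨?_, ?_, ?_⟩ (Set.subset_insert _ _) (Set.mem_insert _ _)
        · rw [Set.disjoint_insert_left]
          exact ⟨hp, h1⟩
        · rintro x (rfl | hx) y (rfl | hy) hxy
          · rfl
          · exact absurd hxy.symm (hi y hy)
          · exact absurd hxy (hi x hx)
          · exact h2 x hx y hy hxy
        · rintro x (rfl | hx) y (rfl | hy) hxy
          · exact absurd rfl hxy
          · exact (hno y hy).1
          · exact (hno x hx).2
          · exact h3 x hx y hy hxy
      exact hi _ hmem rfl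
  choose t i ht1 ht2 ht3 using key
  let Z := μ.ord.ToType
  have hZ : #Z = μ := by simp [Z]
  let T : Z → Set (I × P) := (wellFounded_lt (α := Z)).fix
    (fun ζ rec => t (⋃ η, ⋃ h : η < ζ, rec η h))
  have hT : ∀ ζ, T ζ = t (⋃ η, ⋃ _ : η < ζ, T η) := fun ζ => WellFounded.fix_eq _ _ _
  let row : Z → I := fun ζ => i (⋃ η, ⋃ _ : η < ζ, T η)
  obtain ⟨i0, hi0⟩ := infinite_pigeonhole row (by rw [hZ]; exact hμ.aleph0_le)
    (by rw [hZ, hμ.cof_ord]; exact hI)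
  rw [hZ] at hi0
  have hdis : ∀ η ζ, η < ζ → Disjoint (T ζ) (T η) := by
    intro η ζ h
    rw [hT ζ]
    refine (ht1 _).mono_right ?_
    exact Set.subset_iUnion₂ (s := fun η (_ : η < ζ) => T η) η h
  have hcU : #(⋃ ζ, T ζ : Set (I × P)) ≤ μ := by
    refine (mk_iUnion_le _).trans ?_
    rw [hZ]
    refine mul_le_of_le hμ.aleph0_le le_rfl (ciSup_le' fun ζ => ?_)
    rw [hT]
    exact (ht2 _).trans hI.le
  have hcH : #(⋃ x : (⋃ ζ, T ζ : Set (I × P)), H x.1 : Set (I × P)) ≤ μ := by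
    refine (mk_iUnion_le _).trans ?_
    refine mul_le_of_le hμ.aleph0_le hcU (ciSup_le' fun ζ => ?_)
    exact (hH _).le
  have hp : ∃ p, (i0, p) ∉ (⋃ ζ, T ζ) ∪ (⋃ x : (⋃ ζ, T ζ : Set (I × P)), H x.1) := by
    by_contra hno
    push Not at hno
    have : #P ≤ μ := by
      refine (mk_le_of_injective (f := fun p => (⟨(i0, p), hno p⟩ :
        ↥((⋃ ζ, T ζ) ∪ (⋃ x : (⋃ ζ, T ζ : Set (I × P)), H x.1)))) ?_).trans
        ((mk_union_le _ _).trans (add_le_of_le hμ.aleph0_le hcU hcH))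
      intro p q h
      simpa using h
    exact absurd hP this.not_gt
  obtain ⟨p, hp⟩ := hp
  have hp1 : ∀ ζ, (i0, p) ∉ T ζ := fun ζ h => hp (Or.inl (Set.mem_iUnion.2 ⟨ζ, h⟩))
  have hp2 : ∀ ζ, ∀ y ∈ T ζ, (i0, p) ∉ H y := fun ζ y hy h =>
    hp (Or.inr (Set.mem_iUnion.2 ⟨⟨y, Set.mem_iUnion.2 ⟨ζ, hy⟩⟩, h⟩))
  have hhit : ∀ ζ : row ⁻¹' {i0}, ∃ y ∈ T ζ.1, y ∈ H (i0, p) := by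
    rintro ⟨ζ, hζ⟩
    have hζ' : row ζ = i0 := hζ
    obtain ⟨y, hy, hy'⟩ := ht3 (⋃ η, ⋃ _ : η < ζ, T η) p (by
      change (row ζ, p) ∉ _
      rw [hζ']
      simp only [Set.mem_iUnion, not_exists]
      exact fun η _ => hp1 η)
    change y ∈ H (row ζ, p) ∨ (row ζ, p) ∈ H y at hy'
    rw [← hT] at hy
    rw [hζ'] at hy'
    exact ⟨y, hy, hy'.resolve_right (hp2 ζ y hy)⟩
  choose y hy hy' using hhit
  have : μ ≤ #(H (i0, p)) := by
    rw [← hi0]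
    refine mk_le_of_injective (f := fun ζ => (⟨y ζ, hy' ζ⟩ : H (i0, p))) ?_
    intro a b hab
    have hab' : y a = y b := congrArg Subtype.val hab
    rcases lt_trichotomy a.1 b.1 with h | h | h
    · exact absurd (hab' ▸ hy a) (Set.disjoint_left.1 (hdis _ _ h) (hy b))
    · exact Subtype.ext h
    · exact absurd (hab' ▸ hy b) (Set.disjoint_left.1 (hdis _ _ h) (hy a))
  exact absurd (hH (i0, p)) this.not_gt

theorem lemH {I P X : Type u} (μ : Cardinal.{u}) (hμ : μ.IsRegular) (hI : #I < μ) (hP : μ < #P)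
    (S : I → P → Set X) (hS : ∀ a p b q, (a, p) ≠ (b, q) → Disjoint (S a p) (S b q))
    (lam : I → Cardinal.{u}) (hlam : ∀ a, (lam a).IsRegular) (hlt : ∀ a, μ < lam a)
    (hc : ∀ a p, lam a ≤ #(S a p)) (F : X → Set X) (hF : ∀ x, #(F x) < μ) :
    ∃ δ : I → P, ∀ α, lam α ≤
      #{x | x ∈ S α (δ α) ∧ ∀ β, β ≠ α → Disjoint (F x) (S β (δ β))} := by
  let B : I → P → (I → P) → Set X := fun α p f =>
    {x | x ∈ S α p ∧ ∀ β, β ≠ α → Disjoint (F x) (S β (f β))}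
  have key : ∀ x : I × P, ∃ H : Set (I × P), #H < μ ∧
      ∀ f : I → P, #(B x.1 x.2 f) < lam x.1 → ∃ β, β ≠ x.1 ∧ (β, f β) ∈ H := by
    rintro ⟨α, p⟩
    obtain ⟨𝓕, h𝓕⟩ := zorn_subset {𝓕 : Set (I → P) | (∀ f ∈ 𝓕, #(B α p f) < lam α) ∧
      (∀ f ∈ 𝓕, ∀ g ∈ 𝓕, f ≠ g → ∀ β, β ≠ α → f β ≠ g β)} (by
      intro c hc hchain
      refine ⟨⋃₀ c, ⟨?_, ?_⟩, fun s hs => Set.subset_sUnion_of_mem hs⟩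
      · rintro f ⟨s, hs, hf⟩
        exact (hc hs).1 f hf
      · rintro x ⟨s, hs, hx⟩ y ⟨s', hs', hy⟩
        rcases hchain.total hs hs' with h | h
        · exact (hc hs').2 x (h hx) y hy
        · exact (hc hs).2 x hx y (h hy))
    obtain ⟨⟨h1, h2⟩, hmax⟩ := h𝓕
    have hsmall : #𝓕 < μ := by
      by_contra hno
      rw [not_lt] at hno
      obtain ⟨𝓖, hG, hGc⟩ := le_mk_iff_exists_subset.1 hno
      have hU : #(⋃ g : 𝓖, B α p g.1 : Set X) < lam α := by
        rw [card_iUnion_lt_iff_forall_of_isRegular (hlam α) (by rw [hGc]; exact hlt α)]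
        exact fun g => h1 _ (hG g.2)
      have hx : ∃ x ∈ S α p, x ∉ (⋃ g : 𝓖, B α p g.1 : Set X) := by
        by_contra hno
        push Not at hno
        exact absurd ((hc α p).trans (mk_le_mk_of_subset hno)) hU.not_ge
      obtain ⟨x, hx, hx'⟩ := hx
      have hz : ∀ g : 𝓖, ∃ β z, β ≠ α ∧ z ∈ F x ∧ z ∈ S β (g.1 β) := by
        intro g
        by_contra hno
        push Not at hno
        refine hx' (Set.mem_iUnion.2 ⟨g, hx, fun β hβ => Set.disjoint_left.2 fun z hz => hno β z hβ hz⟩)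
      choose β z hβ hz hz' using hz
      have : μ ≤ #(F x) := by
        rw [← hGc]
        refine mk_le_of_injective (f := fun g => (⟨z g, hz g⟩ : F x)) ?_
        intro g h hgh
        have hgh' : z g = z h := congrArg Subtype.val hgh
        have e : (β g, g.1 (β g)) = (β h, h.1 (β h)) := by
          by_contra hne
          exact Set.disjoint_left.1 (hS _ _ _ _ hne) (hz' g) (hgh' ▸ hz' h)
        have e1 : β g = β h := congrArg Prod.fst e
        have e2 : g.1 (β g) = h.1 (β h) := congrArg Prod.snd e
        rw [← e1] at e2
        by_contra hne
        exact h2 _ (hG g.2) _ (hG h.2) (fun h => hne (Subtype.ext h)) _ (hβ g) e2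
      exact absurd (hF x) this.not_gt
    refine ⟨⋃ f : 𝓕, Set.range (fun β => (β, f.1 β)), ?_, ?_⟩
    · rw [card_iUnion_lt_iff_forall_of_isRegular hμ hsmall]
      exact fun g => mk_range_le.trans_lt hI
    · intro f hf
      change #(B α p f) < lam α at hf
      have hne : ∃ β, β ≠ α := by
        by_contra hno
        push Not at hno
        refine absurd ((hc α p).trans (mk_le_mk_of_subset ?_)) hf.not_ge
        exact fun x hx => ⟨hx, fun β hβ => absurd (hno β) hβ⟩
      by_cases hfm : f ∈ 𝓕
      · obtain ⟨β, hβ⟩ := hne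
        exact ⟨β, hβ, Set.mem_iUnion.2 ⟨⟨f, hfm⟩, β, rfl⟩⟩
      · by_contra hno
        push Not at hno
        have hno' : ∀ g ∈ 𝓕, ∀ β, β ≠ α → f β ≠ g β := by
          intro g hg β hβ e
          exact hno β hβ (Set.mem_iUnion.2 ⟨⟨g, hg⟩, β, by simp [e]⟩)
        refine hfm (hmax (y := insert f 𝓕) ⟨?_, ?_⟩ (Set.subset_insert _ _) (Set.mem_insert _ _))
        · rintro g (rfl | hg)
          · exact hf
          · exact h1 g hg
        · rintro g (rfl | hg) h (rfl | hh) hgh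
          · exact absurd rfl hgh
          · exact hno' h hh
          · exact fun β hβ e => hno' g hg β hβ e.symm
          · exact h2 g hg h hh hgh
  choose H hH1 hH2 using key
  obtain ⟨δ, hδ⟩ := lemT μ hμ hI hP H hH1
  refine ⟨δ, fun α => ?_⟩
  by_contra hno
  rw [not_le] at hno
  obtain ⟨β, hβ, hm⟩ := hH2 (α, δ α) δ hno
  exact hδ α β (Ne.symm hβ) hm

def IsDisc {X : Type u} [TopologicalSpace X] (E : Set X) : Prop :=
  ∀ x ∈ E, ∃ U, IsOpen U ∧ x ∈ U ∧ ∀ y ∈ E, y ∈ U → y = x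

theorem pickD {X I : Type u} (D : I → Set X) (hcov : ∀ x, ∃ k, x ∈ D k) (ρ : Cardinal.{u})
    (hρ : ρ.IsRegular) (hI : #I < ρ) (A : Set X) (hA : ρ ≤ #A) : ∃ k, ρ ≤ #(A ∩ D k : Set X) := by
  by_contra hno
  push Not at hno
  have h := (card_iUnion_lt_iff_forall_of_isRegular hρ hI).2 hno
  refine absurd (hA.trans (mk_le_mk_of_subset ?_)) h.not_ge
  intro x hx
  obtain ⟨k, hk⟩ := hcov x
  exact Set.mem_iUnion.2 ⟨k, hx, hk⟩

theorem claimA {X I Θ : Type u} [TopologicalSpace X] [T3Space X] (D : I → Set X)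
    (hD : ∀ k, IsDisc (D k)) (hcov : ∀ x, ∃ k, x ∈ D k) (hIΘ : #I < #Θ)
    (lam : I → Cardinal.{u}) (hlam : ∀ i, (lam i).IsRegular) (hlt : ∀ i, #Θ < lam i)
    (hcof : ∀ i, ∃ j, lam i < lam j) (R : Set X) (hR : ∀ k, lam k ≤ #R) (i : I) :
    (∃ E : Set X, IsDisc E ∧ ∀ k, lam k ≤ #E) ∨
    ∃ V : Θ → Set X, (∀ t, IsOpen (V t)) ∧
      ∀ s t, s ≠ t → lam i ≤ #((V t \ closure (V s)) ∩ R : Set X) := by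
  let B : Set X := {x | x ∈ R ∧ ∀ U, IsOpen U → x ∈ U → lam i ≤ #(U ∩ R : Set X)}
  by_cases hB : ∃ k, lam k ≤ #B
  · right
    obtain ⟨k, hk⟩ := hB
    obtain ⟨k', hk'⟩ := pickD D hcov (lam k) (hlam k) (hIΘ.trans (hlt k)) B hk
    obtain ⟨f⟩ : Nonempty (Θ ↪ (B ∩ D k' : Set X)) := ((hlt k).le.trans hk')
    have h1 : ∀ t, ∃ V : Set X, IsOpen V ∧ (f t).1 ∈ V ∧ ∀ y ∈ D k', y ∈ closure V → y = (f t).1 := by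
      intro t
      obtain ⟨U, hU, hyU, hU'⟩ := hD k' (f t).1 (f t).2.2
      obtain ⟨C, hC, hCc, hCU⟩ := exists_mem_nhds_isClosed_subset (hU.mem_nhds hyU)
      refine ⟨interior C, isOpen_interior, mem_interior_iff_mem_nhds.2 hC, ?_⟩
      intro y hy hy'
      exact hU' y hy (hCU (closure_minimal interior_subset hCc hy'))
    choose V hV1 hV2 hV3 using h1
    refine ⟨V, hV1, fun s t hst => ?_⟩
    refine (f t).2.1.2 _ ((hV1 t).sdiff isClosed_closure) ⟨hV2 t, fun h => ?_⟩
    exact hst (f.injective (Subtype.ext (hV3 s _ (f t).2.2 h))).symm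
  · left
    push Not at hB
    have hR' : ∀ k, lam k ≤ #(R \ B : Set X) := by
      intro k
      by_contra hno
      rw [not_le] at hno
      refine absurd ((hR k).trans ((mk_le_mk_of_subset ?_).trans (mk_union_le (R \ B) B)))
        (add_lt_of_lt (hlam k).aleph0_le hno (hB k)).not_ge
      intro x hx
      by_cases hxB : x ∈ B
      · exact Or.inr hxB
      · exact Or.inl ⟨hx, hxB⟩
    have hU : ∀ x, ∃ U, IsOpen U ∧ (x ∈ R \ B → x ∈ U) ∧ #(U ∩ R : Set X) < lam i := by
      intro x
      by_cases hx : x ∈ R \ B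
      · by_contra hno
        push Not at hno
        exact hx.2 ⟨hx.1, fun U hU hxU => hno U hU (fun _ => hxU)⟩
      · refine ⟨∅, isOpen_empty, fun h => absurd h hx, ?_⟩
        simpa using (hlam i).pos
    choose U hU1 hU2 hU3 using hU
    obtain ⟨j, hj⟩ := hcof i
    let lam' : I → Cardinal.{u} := fun α => max (lam α) (Order.succ (lam i))
    have hlam' : ∀ α, (lam' α).IsRegular := by
      intro α
      rcases max_choice (lam α) (Order.succ (lam i)) with h | h
      · simp only [lam', h]; exact hlam α
      · simp only [lam', h]; exact isRegular_succ (hlam i).aleph0_le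
    have hlt' : ∀ α, lam i < lam' α := fun α => (Order.lt_succ _).trans_le (le_max_right _ _)
    have hle' : ∀ α, lam' α ≤ #(R \ B : Set X) := fun α =>
      max_le (hR' α) ((Order.succ_le_of_lt hj).trans (hR' j))
    let P := (Order.succ (lam i)).out
    have hP : #P = Order.succ (lam i) := mk_out _
    have hcard : #(Σ α, P × (lam' α).out) ≤ #(R \ B : Set X) := by
      have hinf : ℵ₀ ≤ #(R \ B : Set X) := (hlam i).aleph0_le.trans (hR' i)
      rw [mk_sigma]
      refine (sum_le_mk_mul_iSup _).trans (mul_le_of_le hinf ?_ (ciSup_le' fun α => ?_))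
      · exact (hIΘ.trans (hlt i)).le.trans (hR' i)
      · rw [mk_prod, lift_id, lift_id, hP, mk_out]
        exact mul_le_of_le hinf ((Order.succ_le_of_lt hj).trans (hR' j)) (hle' α)
    obtain ⟨g⟩ : Nonempty ((Σ α, P × (lam' α).out) ↪ (R \ B : Set X)) := hcard
    let T : I → P → Set X := fun α p => Set.range (fun z : (lam' α).out => (g ⟨α, p, z⟩).1)
    have hT : ∀ α p, lam' α ≤ #(T α p) := by
      intro α p
      rw [mk_range_eq, mk_out]
      intro z z' h
      simpa using g.injective (Subtype.ext h)
    have hTR : ∀ α p, T α p ⊆ R \ B := by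
      rintro α p _ ⟨z, rfl⟩
      exact (g _).2
    have hTd : ∀ a p b q, (a, p) ≠ (b, q) → Disjoint (T a p) (T b q) := by
      intro a p b q hne
      rw [Set.disjoint_left]
      rintro _ ⟨z, rfl⟩ ⟨z', h⟩
      have h' := g.injective (Subtype.ext h)
      apply hne
      rw [Sigma.mk.injEq] at h'
      obtain ⟨rfl, h'⟩ := h'
      have := eq_of_heq h'
      rw [Prod.mk.injEq] at this
      rw [this.1]
    have hk : ∀ α p, ∃ k, lam' α ≤ #(T α p ∩ D k : Set X) := fun α p =>
      pickD D hcov _ (hlam' α) ((hIΘ.trans (hlt i)).trans (hlt' α)) _ (hT α p)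
    choose k hk using hk
    obtain ⟨δ, hδ⟩ := lemH (lam i) (hlam i) (hIΘ.trans (hlt i)) (P := P)
      (by rw [hP]; exact Order.lt_succ _) (fun α p => T α p ∩ D (k α p))
      (fun a p b q h => (hTd a p b q h).mono Set.inter_subset_left Set.inter_subset_left)
      lam' hlam' hlt' hk (fun x => U x ∩ R) hU3
    refine ⟨⋃ α, {x | x ∈ T α (δ α) ∩ D (k α (δ α)) ∧
      ∀ β, β ≠ α → Disjoint (U x ∩ R) (T β (δ β) ∩ D (k β (δ β)))}, ?_, ?_⟩
    · intro x hx
      obtain ⟨α, ⟨hx1, hx2⟩, hx3⟩ := Set.mem_iUnion.1 hx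
      obtain ⟨O, hO, hxO, hO'⟩ := hD _ x hx2
      refine ⟨U x ∩ O, (hU1 x).inter hO, ⟨hU2 x (hTR _ _ hx1), hxO⟩, ?_⟩
      intro y hy hyU
      obtain ⟨β, hy1, hy3⟩ := Set.mem_iUnion.1 hy
      by_cases hβ : β = α
      · subst hβ
        exact hO' y hy1.2 hyU.2
      · exact absurd hy1 (Set.disjoint_left.1 (hx3 β hβ) ⟨hyU.1, (hTR _ _ hy1.1).1⟩)
    · intro α
      refine (le_max_left _ _).trans ((hδ α).trans (mk_le_mk_of_subset ?_))
      exact Set.subset_iUnion (fun α => {x | x ∈ T α (δ α) ∩ D (k α (δ α)) ∧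
      ∀ β, β ≠ α → Disjoint (U x ∩ R) (T β (δ β) ∩ D (k β (δ β)))}) α

inductive Code (I Θ : Type u) : Type u
  | leaf : Code I Θ
  | node : I → Θ → Θ → (I → Code I Θ) → Code I Θ

def Code.enc {I Θ : Type u} (e : Option ((I × Θ × Θ) × (I → Θ)) → Θ) : Code I Θ → Θ
  | .leaf => e none
  | .node i s t f => e (some ((i, s, t), fun j => (f j).enc e))

theorem Code.enc_inj {I Θ : Type u} (e : Option ((I × Θ × Θ) × (I → Θ)) → Θ)
    (he : Function.Injective e) : Function.Injective (Code.enc e) := by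
  intro a
  induction a with
  | leaf =>
    intro b h
    cases b with
    | leaf => rfl
    | node i s t f => simp only [Code.enc] at h; exact absurd (he h) (by simp)
  | node i s t f ih =>
    intro b h
    cases b with
    | leaf => simp only [Code.enc] at h; exact absurd (he h) (by simp)
    | node i' s' t' f' =>
      simp only [Code.enc] at h
      have h' := he h
      simp only [Option.some.injEq, Prod.mk.injEq] at h'
      obtain ⟨⟨rfl, rfl, rfl⟩, h4⟩ := h'
      congr 1
      funext j
      exact ih j (congrFun h4 j)

theorem Code.card_le {I Θ : Type u} (hI : #I ≤ #Θ) (hinf : ℵ₀ ≤ #Θ) (hΘ : #Θ ^ #I ≤ #Θ) :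
    #(Code I Θ) ≤ #Θ := by
  have : #(Option ((I × Θ × Θ) × (I → Θ))) ≤ #Θ := by
    rw [mk_option]
    refine add_le_of_le hinf ?_ (one_le_aleph0.trans hinf)
    simp only [mk_prod, lift_id, mk_pi, prod_const]
    exact mul_le_of_le hinf (mul_le_of_le hinf hI (mul_le_of_le hinf le_rfl le_rfl)) hΘ
  obtain ⟨e⟩ := this
  exact mk_le_of_injective (Code.enc_inj e e.injective)

def Code.ev {I Θ X : Type u} [TopologicalSpace X] (G : Set X → I → Θ → Set X) :
    Code I Θ → Set X
  | .leaf => ∅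
  | .node i s t f => G (⋃ j, (f j).ev G)ᶜ i t \ closure (G (⋃ j, (f j).ev G)ᶜ i s)

theorem Code.isOpen_ev {I Θ X : Type u} [TopologicalSpace X] (G : Set X → I → Θ → Set X)
    (hG : ∀ R i t, IsOpen (G R i t)) (w : Code I Θ) : IsOpen (w.ev G) := by
  cases w with
  | leaf => exact isOpen_empty
  | node i s t f => exact (hG _ _ _).sdiff isClosed_closure

theorem mainL {X I Θ : Type u} [TopologicalSpace X] [T3Space X] (D : I → Set X)
    (hD : ∀ k, IsDisc (D k)) (hcov : ∀ x, ∃ k, x ∈ D k) (hinf : ℵ₀ ≤ #I)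
    (h2 : (2 : Cardinal.{u}) ^ #I < #Θ) (hΘ : #Θ ^ #I ≤ #Θ)
    (lam : I → Cardinal.{u}) (hlam : ∀ i, (lam i).IsRegular) (hlt : ∀ i, #Θ < lam i)
    (hcof : ∀ i, ∃ j, lam i < lam j) (hX : ∀ k, lam k ≤ #X) :
    ∃ E : Set X, IsDisc E ∧ ∀ k, lam k ≤ #E := by
  classical
  by_contra hcon
  have hIΘ : #I < #Θ := (cantor _).trans h2
  have hΘinf : ℵ₀ ≤ #Θ := hinf.trans hIΘ.le
  have hG : ∀ (R : Set X) (i : I), ∃ V : Θ → Set X, (∀ t, IsOpen (V t)) ∧ ((∀ k, lam k ≤ #R) →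
      ∀ s t, s ≠ t → lam i ≤ #((V t \ closure (V s)) ∩ R : Set X)) := by
    intro R i
    by_cases hR : ∀ k, lam k ≤ #R
    · obtain ⟨V, hV, hV'⟩ := (claimA D hD hcov hIΘ lam hlam hlt hcof R hR i).resolve_left hcon
      exact ⟨V, hV, fun _ => hV'⟩
    · exact ⟨fun _ => ∅, fun _ => isOpen_empty, fun h => absurd h hR⟩
  choose G hG1 hG2 using hG
  let C := Code I Θ
  have hC : #C ≤ #Θ := Code.card_le hIΘ.le hΘinf hΘ
  let J := (I → C) ⊕ ((I → C) × I)
  have hJ : #J ≤ #Θ := by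
    have h1 : #(I → C) ≤ #Θ := by
      simp only [mk_pi, prod_const, lift_id]
      exact (power_le_power_right hC).trans hΘ
    simp only [J, mk_sum, mk_prod, lift_id]
    exact add_le_of_le hΘinf h1 (mul_le_of_le hΘinf h1 hIΘ.le)
  let A1 : (I → C) → Set X := fun f => (⋃ j, (f j).ev G)ᶜ
  let A2 : (I → C) → I → Set X := fun f i => (f i).ev G \ ⋃ j, ⋃ _ : j ≠ i, (f j).ev G
  let A : J → Set X := Sum.elim A1 (fun q => A2 q.1 q.2)
  let gen : I → X → Prop := fun i e => ∀ j, e ∈ A j → lam i ≤ #(A j)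
  have hgen : ∀ i (Q : Set X), lam i ≤ #Q → ∃ e ∈ Q, gen i e := by
    intro i Q hQ
    have hb : #(⋃ j : {j // #(A j) < lam i}, A j.1 : Set X) < lam i := by
      rw [card_iUnion_lt_iff_forall_of_isRegular (hlam i)
        (((mk_subtype_le _).trans hJ).trans_lt (hlt i))]
      exact fun j => j.2
    by_contra hno
    push Not at hno
    refine absurd (hQ.trans (mk_le_mk_of_subset ?_)) hb.not_ge
    intro e he
    have := hno e he
    simp only [gen, not_forall, not_le] at this
    obtain ⟨j, hj, hj'⟩ := this
    exact Set.mem_iUnion.2 ⟨⟨j, hj'⟩, hj⟩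
  have hc : ∀ l, ∃ c, gen l c := by
    intro l
    obtain ⟨c, -, hc⟩ := hgen l Set.univ (by rw [mk_univ]; exact hX l)
    exact ⟨c, hc⟩
  choose c hc using hc
  obtain ⟨_, _⟩ := exists_wellFoundedLT I
  let Pr : I → (I → C × X) → C × X → Prop := fun i g v =>
    (∀ j, j < i → (g j).2 ∉ v.1.ev G) ∧ (∀ l, c l ∉ v.1.ev G) ∧ v.2 ∈ v.1.ev G ∧
      (∀ j, j < i → v.2 ∉ (g j).1.ev G) ∧ gen i v.2
  have hstep : ∀ i (g : I → C × X), ∃ v : C × X,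
      (∀ j, j < i → ∀ l, c l ∉ (g j).1.ev G) → Pr i g v := by
    intro i g
    by_cases hg : ∀ j, j < i → ∀ l, c l ∉ (g j).1.ev G
    swap
    · exact ⟨(Code.leaf, c i), fun h => absurd h hg⟩
    let f : I → C := fun j => if j < i then (g j).1 else Code.leaf
    have hR : ∀ k, lam k ≤ #(A1 f) := by
      intro k
      refine hc k (Sum.inl f) ?_
      change c k ∈ A1 f
      simp only [A1, Set.mem_compl_iff, Set.mem_iUnion, not_exists]
      intro j
      by_cases hj : j < i
      · simp only [f, if_pos hj]; exact hg j hj k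
      · simp only [f, if_neg hj]; exact id
    let τ : Θ → Set I × Set I := fun t => ({j | (g j).2 ∈ G (A1 f) i t}, {l | c l ∈ G (A1 f) i t})
    have hτ : ¬ Function.Injective τ := by
      intro h
      have h' := mk_le_of_injective h
      simp only [mk_prod, lift_id, mk_set] at h'
      rw [mul_eq_self (hinf.trans (cantor _).le)] at h'
      exact absurd h2 h'.not_gt
    simp only [Function.Injective, not_forall] at hτ
    obtain ⟨s, t, hst, hne⟩ := hτ
    have hst1 : ∀ j, (g j).2 ∈ G (A1 f) i s ↔ (g j).2 ∈ G (A1 f) i t := fun j =>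
      Set.ext_iff.1 (congrArg Prod.fst hst) j
    have hst2 : ∀ j, c j ∈ G (A1 f) i s ↔ c j ∈ G (A1 f) i t := fun j =>
      Set.ext_iff.1 (congrArg Prod.snd hst) j
    obtain ⟨e, he, he'⟩ := hgen i _ (hG2 (A1 f) i hR s t hne)
    refine ⟨(Code.node i s t f, e), fun _ => ⟨?_, ?_, ?_, ?_, he'⟩⟩
    · intro j _ h
      exact h.2 (subset_closure ((hst1 j).2 h.1))
    · intro j h
      exact h.2 (subset_closure ((hst2 j).2 h.1))
    · exact he.1
    · intro j hj h
      refine he.2 (Set.mem_iUnion.2 ⟨j, ?_⟩)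
      simp only [f, if_pos hj]
      exact h
  choose step hstep using hstep
  let h : I → C × X := (wellFounded_lt (α := I)).fix
    (fun i rec => step i (fun j => if hj : j < i then rec j hj else (Code.leaf, c i)))
  have hh : ∀ i, h i = step i (fun j => if j < i then h j else (Code.leaf, c i)) := by
    intro i
    exact WellFounded.fix_eq _ _ _
  have hPr0 : ∀ i, (∀ j, j < i → ∀ l, c l ∉ (h j).1.ev G) → Pr i h (h i) := by
    intro i hi
    have := hstep i (fun j => if j < i then h j else (Code.leaf, c i)) (by
      intro j hj
      simp only [if_pos hj]
      exact hi j hj)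
    rw [← hh] at this
    obtain ⟨p1, p2, p3, p4, p5⟩ := this
    refine ⟨?_, p2, p3, ?_, p5⟩
    · intro j hj
      have := p1 j hj
      simpa only [if_pos hj] using this
    · intro j hj
      have := p4 j hj
      simpa only [if_pos hj] using this
  have hcl : ∀ i, ∀ l, c l ∉ (h i).1.ev G := by
    intro i
    induction i using (wellFounded_lt (α := I)).induction with
    | _ i ih => exact (hPr0 i ih).2.1
  have hPr : ∀ i, Pr i h (h i) := fun i => hPr0 i (fun j _ => hcl j)
  let w : I → C := fun i => (h i).1
  have hA2 : ∀ i, lam i ≤ #(A2 w i) := by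
    intro i
    refine (hPr i).2.2.2.2 (Sum.inr (w, i)) ⟨(hPr i).2.2.1, ?_⟩
    simp only [Set.mem_iUnion, not_exists]
    intro j hj
    rcases lt_or_gt_of_ne hj with hj | hj
    · exact (hPr i).2.2.2.1 j hj
    · exact (hPr j).1 i hj
  have hk : ∀ i, ∃ k, lam i ≤ #(A2 w i ∩ D k : Set X) := fun i =>
    pickD D hcov _ (hlam i) (hIΘ.trans (hlt i)) _ (hA2 i)
  choose k hk using hk
  refine hcon ⟨⋃ i, A2 w i ∩ D (k i), ?_, fun i => (hk i).trans (mk_le_mk_of_subset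
    (Set.subset_iUnion (fun i => A2 w i ∩ D (k i)) i))⟩
  intro x hx
  obtain ⟨i, hx1, hx2⟩ := Set.mem_iUnion.1 hx
  obtain ⟨O, hO, hxO, hO'⟩ := hD _ x hx2
  refine ⟨(w i).ev G ∩ O, (Code.isOpen_ev G hG1 _).inter hO, ⟨hx1.1, hxO⟩, ?_⟩
  intro y hy hyU
  obtain ⟨j, hy1, hy2⟩ := Set.mem_iUnion.1 hy
  by_cases hji : j = i
  · subst hji
    exact hO' y hy2 hyU.2
  · exact (hy1.2 (Set.mem_iUnion₂.2 ⟨i, fun e => hji e.symm, hyU.1⟩)).elim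

theorem pow_fix {I : Type u} (hinf : ℵ₀ ≤ #I) :
    (Order.succ ((2 : Cardinal.{u}) ^ #I)) ^ #I ≤ Order.succ ((2 : Cardinal.{u}) ^ #I) := by
  set θ := Order.succ ((2 : Cardinal.{u}) ^ #I) with hθ
  have h2inf : ℵ₀ ≤ (2 : Cardinal.{u}) ^ #I := hinf.trans (cantor _).le
  have hreg : θ.IsRegular := isRegular_succ h2inf
  have hI : #I < θ := (cantor _).trans (Order.lt_succ _)
  let Θ := θ.ord.ToType
  have hΘ : #Θ = θ := by simp [Θ]
  have hIic : ∀ a : Θ, #(Set.Iic a) < θ := by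
    intro a
    have h1 : #(Set.Iio a) < θ := by
      have := mk_Iio_toType_ord_lt a
      exact this
    have h2 : (Set.Iic a) = insert a (Set.Iio a) := by
      ext x; simp [le_iff_eq_or_lt]
    rw [h2]
    exact mk_insert_le.trans_lt (add_lt_of_lt hreg.aleph0_le h1
      (one_lt_aleph0.trans_le hreg.aleph0_le))
  have hbd : ∀ f : I → Θ, ∃ a, ∀ i, f i ≤ a := by
    intro f
    have h := (card_iUnion_lt_iff_forall_of_isRegular hreg hI (t := fun i => Set.Iic (f i))).2
      (fun i => hIic (f i))
    by_contra hno
    push Not at hno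
    have : (Set.univ : Set Θ) ⊆ ⋃ i, Set.Iic (f i) := by
      intro a _
      obtain ⟨i, hi⟩ := hno a
      exact Set.mem_iUnion.2 ⟨i, hi.le⟩
    have := mk_le_mk_of_subset this
    rw [mk_univ, hΘ] at this
    exact absurd h this.not_gt
  choose a ha using hbd
  have : #(I → Θ) ≤ #(Σ a : Θ, (I → Set.Iic a)) := by
    refine mk_le_of_injective (f := fun f => ⟨a f, fun i => ⟨f i, ha f i⟩⟩) ?_
    have : Function.LeftInverse (fun q : (Σ a : Θ, (I → Set.Iic a)) => fun i => (q.2 i).1)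
      (fun f => ⟨a f, fun i => ⟨f i, ha f i⟩⟩) := fun f => rfl
    exact this.injective
  rw [mk_sigma] at this
  simp only [mk_pi, prod_const, lift_id] at this
  rw [hΘ] at this
  refine this.trans ((sum_le_mk_mul_iSup _).trans ?_)
  rw [hΘ]
  refine mul_le_of_le hreg.aleph0_le le_rfl (ciSup_le' fun b => ?_)
  refine (power_le_power_right (Order.lt_succ_iff.1 (hIic b))).trans ?_
  rw [← power_mul, mul_eq_self hinf]
  exact (Order.lt_succ _).le

theorem isDisc_of {X : Type u} [TopologicalSpace X] {E : Set X} (h : DiscreteTopology E) :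
    IsDisc E := by
  intro x hx
  obtain ⟨U, hU, hU'⟩ := discreteTopology_subtype_iff'.1 h x hx
  refine ⟨U, hU, (hU'.ge rfl).1, fun y hy hyU => hU'.le ⟨hyU, hy⟩⟩

theorem of_isDisc {X : Type u} [TopologicalSpace X] {E : Set X} (h : IsDisc E) :
    DiscreteTopology E := by
  rw [discreteTopology_subtype_iff']
  intro x hx
  obtain ⟨U, hU, hxU, hU'⟩ := h x hx
  refine ⟨U, hU, ?_⟩
  ext y
  exact ⟨fun hy => hU' y hy.2 hy.1, fun hy => hy ▸ ⟨hxU, hx⟩⟩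

theorem stmt11 (X : Type u) [TopologicalSpace X] [T3Space X] [Infinite X] :
    sPlus X < (2 : Cardinal.{u}) ^ (sPlus X).ord.cof := by
  have hbdd : BddAbove {c : Cardinal.{u} | ∃ D : Set X, DiscreteTopology D ∧ c = Order.succ #D} := by
    refine ⟨Order.succ #X, ?_⟩
    rintro _ ⟨D, -, rfl⟩
    exact Order.succ_le_succ (mk_set_le D)
  have hup : ∀ D : Set X, IsDisc D → #D < sPlus X := fun D hD =>
    (Order.lt_succ _).trans_le (le_csSup hbdd ⟨D, of_isDisc hD, rfl⟩)
  have hlow : ∀ μ, μ < sPlus X → ∃ D : Set X, IsDisc D ∧ μ ≤ #D := by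
    intro μ hμ
    obtain ⟨_, ⟨D, hD, rfl⟩, h⟩ := exists_lt_of_lt_csSup' hμ
    exact ⟨D, isDisc_of hD, Order.lt_succ_iff.1 h⟩
  generalize hL : sPlus X = L at *
  have hinf : ℵ₀ ≤ L := by
    rw [aleph0_le]
    intro n
    obtain ⟨s, hs⟩ := Infinite.exists_subset_card_eq X n
    have := hup (s : Set X) (isDisc_of (by
      have : Finite (s : Set X) := s.finite_toSet
      infer_instance))
    simpa [hs] using this.le
  by_contra hcon
  rw [not_lt] at hcon
  rcases isRegular_or_isSingular hinf with hreg | hsing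
  · rw [hreg.cof_ord] at hcon
    exact absurd (cantor L) hcon.not_gt
  have hκL := hsing.cof_ord_lt
  have hκinf : ℵ₀ ≤ L.ord.cof := by
    exact Ordinal.aleph0_le_cof.2 (isSuccLimit_ord hinf)
  have h2L : (2 : Cardinal.{u}) ^ L.ord.cof < L := by
    refine lt_of_le_of_ne hcon fun h => ?_
    have := lt_cof_ord_power hκinf (b := 2) Cardinal.one_lt_two
    rw [h] at this
    exact lt_irrefl _ this
  have hlim := hsing.isSuccLimit
  obtain ⟨s, hs, hsc⟩ := Order.exists_cof_eq L.ord.ToType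
  rw [Ordinal.cof_toType] at hsc
  rw [← hsc] at hκL hκinf h2L
  set θ := Order.succ ((2 : Cardinal.{u}) ^ #s) with hθ
  have hθL : θ < L := hlim.succ_lt h2L
  let f : s → Cardinal.{u} := fun i => #(Set.Iio i.1)
  have hfL : ∀ i, f i < L := fun i => mk_Iio_toType_ord_lt i.1
  have hfcof : ∀ μ, μ < L → ∃ i, μ ≤ f i := by
    intro μ hμ
    by_contra hno
    push Not at hno
    have hsub : (Set.univ : Set L.ord.ToType) ⊆ ⋃ i : s, Set.Iic i.1 := by
      intro x _
      obtain ⟨y, hy, hxy⟩ := hs x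
      exact Set.mem_iUnion.2 ⟨⟨y, hy⟩, hxy⟩
    have h1 := (mk_le_mk_of_subset hsub).trans (mk_iUnion_le _)
    rw [mk_univ, mk_ord_toType] at h1
    have h2 : ⨆ i : s, #(Set.Iic i.1) ≤ μ + 1 := by
      refine ciSup_le' fun i => ?_
      have h2 : (Set.Iic i.1) = insert i.1 (Set.Iio i.1) := by
        ext x; simp [le_iff_eq_or_lt]
      rw [h2]
      exact mk_insert_le.trans (by gcongr; exact (hno i).le)
    exact absurd (h1.trans (mul_le_mul_right h2 _)) (mul_lt_of_lt hinf hκL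
      (add_lt_of_lt hinf hμ (one_lt_aleph0.trans_le hinf))).not_ge
  let lam : s → Cardinal.{u} := fun i => Order.succ (max (f i) θ)
  have hlamL : ∀ i, lam i < L := fun i => hlim.succ_lt (max_lt (hfL i) hθL)
  have hlcof : ∀ μ, μ < L → ∃ i, μ < lam i := by
    intro μ hμ
    obtain ⟨i, hi⟩ := hfcof μ hμ
    exact ⟨i, Order.lt_succ_iff.2 (hi.trans (le_max_left _ _))⟩
  have hθinf : ℵ₀ ≤ θ := (hκinf.trans (cantor _).le).trans (Order.lt_succ _).le
  have hD : ∀ i, ∃ D : Set X, IsDisc D ∧ lam i ≤ #D := fun i => hlow _ (hlamL i)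
  choose D hD hDc using hD
  let Z := (⋃ i, D i : Set X)
  obtain ⟨E, hE, hEc⟩ := mainL (X := Z) (I := s) (Θ := θ.out) (fun i => Subtype.val ⁻¹' D i)
    (by
      intro k x hx
      obtain ⟨U, hU, hxU, hU'⟩ := hD k x.1 hx
      exact ⟨Subtype.val ⁻¹' U, hU.preimage continuous_subtype_val, hxU,
        fun y hy hyU => Subtype.ext (hU' y.1 hy hyU)⟩)
    (by
      rintro ⟨x, hx⟩
      obtain ⟨i, hi⟩ := Set.mem_iUnion.1 (show x ∈ ⋃ i, D i from hx)
      exact ⟨i, hi⟩)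
    hκinf (by rw [mk_out]; exact Order.lt_succ _) (by rw [mk_out]; exact pow_fix hκinf)
    lam (fun i => isRegular_succ (hθinf.trans (le_max_right _ _)))
    (fun i => by rw [mk_out]; exact Order.lt_succ_iff.2 (le_max_right _ _))
    (fun i => hlcof _ (hlamL i))
    (fun k => (hDc k).trans (mk_le_mk_of_subset (Set.subset_iUnion D k)))
  have h1 : #(Subtype.val '' E : Set X) = #E := mk_image_eq Subtype.val_injective
  have h2 := hup (Subtype.val '' E) (by
    rintro _ ⟨x, hx, rfl⟩
    obtain ⟨U, hU, hxU, hU'⟩ := hE x hx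
    obtain ⟨W, hW, rfl⟩ := isOpen_induced_iff.1 hU
    refine ⟨W, hW, hxU, ?_⟩
    rintro _ ⟨y, hy, rfl⟩ hyW
    rw [hU' y hy hyW])
  rw [h1] at h2
  obtain ⟨i, hi⟩ := hlcof _ h2
  exact absurd (hEc i) hi.not_ge
end
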